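/- Let (X, cl) be a pregeometry and let U, V, W be pairwise disjoint nonempty finite subsets of X such that U ∪ V and V ∪ W are minimal dependent and dim(U ∪ V ∪ W) = |U| + |V| + |W| − 2. Then there exists a proper subset V* ⊊ V (possibly empty) such that U ∪ V* ∪ W is minimal dependent. -/

import Mathlib

/-- A pregeometry: a closure operator with reflexivity, monotonicity, idempotence,
finite character and the exchange property. -/
structure Pregeom (X : Type*) where
  cl : Set X → Set X
  subset_cl : ∀ A : Set X, A ⊆ cl A
  mono : ∀ {A B : Set X}, A ⊆ B → cl A ⊆ cl B
  idem : ∀ A : Set X, cl (cl A) = cl A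
  finChar : ∀ {a : X} {A : Set X}, a ∈ cl A → ∃ A₀ ⊆ A, A₀.Finite ∧ a ∈ cl A₀
  exchange : ∀ {a b : X} {A : Set X}, a ∈ cl (A ∪ {b}) → a ∉ cl A → b ∈ cl (A ∪ {a})

namespace Pregeom

variable {X : Type*}

/-- A set is independent if no element lies in the closure of the remaining elements. -/
def Indep (G : Pregeom X) (Y : Set X) : Prop := ∀ y ∈ Y, y ∉ G.cl (Y \ {y})

/-- A set is dependent if it is not independent. -/
def Dep (G : Pregeom X) (Y : Set X) : Prop := ¬ G.Indep Y

/-- A set is minimal dependent if it is dependent and every proper subset is independent. -/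
def MinDep (G : Pregeom X) (Y : Set X) : Prop := G.Dep Y ∧ ∀ Z ⊂ Y, G.Indep Z

/-- `Z` is a basis of `Y`: an independent subset of `Y` whose closure contains `Y`. -/
def IsBasis (G : Pregeom X) (Z Y : Set X) : Prop := Z ⊆ Y ∧ G.Indep Z ∧ Y ⊆ G.cl Z

end Pregeom

namespace Pregeom

variable {X : Type*}

theorem Indep.subset {G : Pregeom X} {I J : Set X} (hJ : G.Indep J) (h : I ⊆ J) : G.Indep I :=
  fun y hy hc => hJ y (h hy) (G.mono (Set.sdiff_subset_sdiff_left h) hc)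

theorem cl_subset_of_subset_cl (G : Pregeom X) {A B : Set X} (h : A ⊆ G.cl B) :
    G.cl A ⊆ G.cl B :=
  G.idem B ▸ G.mono h

/-- If `y` lies in the closure of `A \ {y}`, then `A` and `A \ {y}` span the same set. -/
theorem subset_cl_diff_singleton (G : Pregeom X) {A : Set X} {y : X}
    (h : y ∈ G.cl (A \ {y})) : A ⊆ G.cl (A \ {y}) := by
  intro x hx
  by_cases hxy : x = y
  · exact hxy ▸ h
  · exact G.subset_cl _ ⟨hx, hxy⟩

/-- Steinitz exchange, one step: a point `x` of `cl S` outside `cl A`, with `A ⊆ S` and `S`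
finite, can replace a point of `S \ A`. -/
theorem exists_exchange (G : Pregeom X) {A S : Set X} {x : X} (hS : S.Finite) (hAS : A ⊆ S)
    (hxS : x ∈ G.cl S) (hxA : x ∉ G.cl A) :
    ∃ s ∈ S \ A, S ⊆ G.cl (insert x (S \ {s})) := by
  have hfin : {B : Set X | B ⊆ S ∧ x ∉ G.cl B}.Finite :=
    hS.finite_subsets.subset fun B hB => hB.1
  obtain ⟨B, hAB, hB⟩ := hfin.exists_le_maximal (a := A) ⟨hAS, hxA⟩
  obtain ⟨s, hsS, hsB⟩ : ∃ s ∈ S, s ∉ B := by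
    by_contra! h
    exact hB.prop.2 (G.mono h hxS)
  have hx : x ∈ G.cl (B ∪ {s}) := by
    by_contra hx
    exact hsB (hB.le_of_ge (y := B ∪ {s})
      ⟨Set.union_subset hB.prop.1 (Set.singleton_subset_iff.2 hsS), hx⟩
      Set.subset_union_left (Or.inr rfl))
  have hs : s ∈ G.cl (insert x (S \ {s})) := by
    refine G.mono ?_ (G.exchange hx hB.prop.2)
    rintro z (hz | rfl)
    · exact Or.inr ⟨hB.prop.1 hz, fun h => hsB (h ▸ hz)⟩
    · exact Or.inl rfl
  refine ⟨s, ⟨hsS, fun h => hsB (hAB h)⟩, fun z hz => ?_⟩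
  by_cases hzs : z = s
  · exact hzs ▸ hs
  · exact G.subset_cl _ (Or.inr ⟨hz, hzs⟩)

theorem Indep.ncard_le {G : Pregeom X} {I : Set X} (hI : G.Indep I) {S : Set X} (hS : S.Finite)
    (hIS : I ⊆ G.cl S) : I.ncard ≤ S.ncard := by
  induction hn : (S \ I).ncard using Nat.strong_induction_on generalizing S with
  | _ n ih =>
    by_cases hsub : I ⊆ S
    · exact Set.ncard_le_ncard hsub hS
    obtain ⟨x, hxI, hxS⟩ := Set.not_subset.1 hsub
    have hxA : x ∉ G.cl (I ∩ S) := fun h =>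
      hI x hxI (G.mono (Set.subset_sdiff_singleton Set.inter_subset_left fun h => hxS h.2) h)
    obtain ⟨s, ⟨hsS, hsI⟩, hspan⟩ :=
      G.exists_exchange hS Set.inter_subset_right (hIS hxI) hxA
    have hlt : (insert x (S \ {s}) \ I).ncard < n := by
      rw [← hn]
      refine Set.ncard_lt_ncard ⟨?_, fun h => ?_⟩ hS.sdiff
      · rintro z ⟨rfl | hz, hzI⟩
        · exact absurd hxI hzI
        · exact ⟨hz.1, hzI⟩
      · have hsI' : s ∉ I := fun h => hsI ⟨h, hsS⟩
        rcases (h ⟨hsS, hsI'⟩).1 with rfl | h'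
        · exact hxS hsS
        · exact h'.2 rfl
    have hle := ih _ hlt (hS.sdiff.insert x)
      (hIS.trans (G.cl_subset_of_subset_cl hspan)) rfl
    rwa [Set.ncard_exchange hxS hsS] at hle

/-- A finite spanning set with at most as many elements as an independent set it spans is
independent. -/
theorem Indep.indep_of_ncard_le {G : Pregeom X} {I S : Set X} (hI : G.Indep I) (hS : S.Finite)
    (hIS : I ⊆ G.cl S) (hcard : S.ncard ≤ I.ncard) : G.Indep S := by
  intro y hy hc
  have h := hI.ncard_le hS.sdiff
    (hIS.trans (G.cl_subset_of_subset_cl (G.subset_cl_diff_singleton hc)))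
  have := Set.ncard_sdiff_singleton_lt_of_mem hy hS
  omega

theorem Dep.exists_minDep_subset {G : Pregeom X} {S : Set X} (h : G.Dep S) (hS : S.Finite) :
    ∃ C ⊆ S, G.MinDep C := by
  have hfin : {B : Set X | B ⊆ S ∧ G.Dep B}.Finite := hS.finite_subsets.subset fun B hB => hB.1
  obtain ⟨C, -, hC⟩ := hfin.exists_le_minimal (a := S) ⟨subset_rfl, h⟩
  refine ⟨C, hC.prop.1, hC.prop.2, fun Z hZ => ?_⟩
  by_contra hZd
  exact hZ.2 (hC.le_of_le ⟨hZ.1.trans hC.prop.1, hZd⟩ hZ.1)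

theorem MinDep.mem_cl_diff_singleton {G : Pregeom X} {C : Set X} (hC : G.MinDep C) {x : X}
    (hx : x ∈ C) : x ∈ G.cl (C \ {x}) := by
  have hdep := hC.1
  simp only [Dep, Indep, not_forall, not_not] at hdep
  obtain ⟨y, hy, hyc⟩ := hdep
  by_contra hxc
  have hyx : y ≠ x := by
    rintro rfl
    exact hxc hyc
  have hyx' : y ∉ G.cl ((C \ {x}) \ {y}) :=
    hC.2 _ (Set.sdiff_singleton_ssubset.2 hx) y ⟨hy, hyx⟩
  have heq : C \ {y} = ((C \ {x}) \ {y}) ∪ {x} := by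
    ext z
    by_cases hz : z = x
    · subst hz
      simp [hx, hyx.symm]
    · simp [hz]
  rw [heq] at hyc
  refine hxc (G.mono ?_ (G.exchange hyc hyx'))
  rintro z (hz | rfl)
  · exact hz.1
  · exact ⟨hy, hyx⟩

/-- Removing a point from each of two minimal dependent sets, the first point lying outside the
second set, does not change the span of a set containing both. -/
theorem subset_cl_diff_pair (G : Pregeom X) {C D E : Set X} (hC : G.MinDep C) (hD : G.MinDep D)
    (hCE : C ⊆ E) (hDE : D ⊆ E) {u v : X} (hu : u ∈ C) (huD : u ∉ D) (hv : v ∈ D) :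
    E ⊆ G.cl (E \ {u, v}) := by
  have hvcl : v ∈ G.cl (E \ {u, v}) := by
    refine G.mono ?_ (hD.mem_cl_diff_singleton hv)
    refine fun z hz => ⟨hDE hz.1, ?_⟩
    rintro (rfl | h)
    · exact huD hz.1
    · exact hz.2 h
  have hdiff : E \ {u} ⊆ G.cl (E \ {u, v}) := by
    intro z hz
    by_cases hzv : z = v
    · exact hzv ▸ hvcl
    · exact G.subset_cl _ ⟨hz.1, by rintro (h | h); exacts [hz.2 h, hzv h]⟩
  have hucl : u ∈ G.cl (E \ {u}) :=
    G.mono (Set.sdiff_subset_sdiff_left hCE) (hC.mem_cl_diff_singleton hu)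
  exact (G.subset_cl_diff_singleton hucl).trans (G.cl_subset_of_subset_cl hdiff)

end Pregeom

theorem stmt7 {X : Type*} (G : Pregeom X) (U V W : Set X)
    (hUfin : U.Finite) (hVfin : V.Finite) (hWfin : W.Finite)
    (hUne : U.Nonempty) (hVne : V.Nonempty) (hWne : W.Nonempty)
    (hUV : Disjoint U V) (hUW : Disjoint U W) (hVW : Disjoint V W)
    (hmd1 : G.MinDep (U ∪ V)) (hmd2 : G.MinDep (V ∪ W))
    (hdim : ∃ Z : Set X, G.IsBasis Z (U ∪ V ∪ W) ∧
      Z.ncard = U.ncard + V.ncard + W.ncard - 2) :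
    ∃ Vs : Set X, Vs ⊂ V ∧ G.MinDep (U ∪ Vs ∪ W) := by
  obtain ⟨Z, ⟨hZE, hZ, hEZ⟩, hZcard⟩ := hdim
  obtain ⟨v, hv⟩ := hVne
  set E := U ∪ V ∪ W with hE
  have hEfin : E.Finite := (hUfin.union hVfin).union hWfin
  have hEcard : E.ncard = U.ncard + V.ncard + W.ncard := by
    rw [hE, Set.ncard_union_eq (Set.disjoint_union_left.2 ⟨hUW, hVW⟩) (hUfin.union hVfin) hWfin,
      Set.ncard_union_eq hUV hUfin hVfin]
  have hUpos := (Set.ncard_pos hUfin).2 hUne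
  have hWpos := (Set.ncard_pos hWfin).2 hWne
  have hUVE : U ∪ V ⊆ E := Set.subset_union_left
  have hVWE : V ∪ W ⊆ E := Set.union_subset_union_left W Set.subset_union_right
  have hvE : v ∈ E := hUVE (Or.inr hv)
  have hdep : G.Dep (E \ {v}) := by
    intro hind
    have h := hind.ncard_le (hEfin.subset hZE) (Set.sdiff_subset.trans hEZ)
    rw [Set.ncard_sdiff_singleton_of_mem hvE] at h
    omega
  have hpair : ∀ x ∈ E, x ≠ v → E ⊆ G.cl (E \ {x, v}) → G.Indep (E \ {x, v}) := by
    intro x hx hxv hspan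
    refine hZ.indep_of_ncard_le hEfin.sdiff (hZE.trans hspan) ?_
    rw [Set.ncard_sdiff (Set.insert_subset hx (Set.singleton_subset_iff.2 hvE)),
      Set.ncard_pair hxv]
    omega
  obtain ⟨C, hCE, hC⟩ := hdep.exists_minDep_subset hEfin.sdiff
  have hmem : ∀ x ∈ E, x ≠ v → E ⊆ G.cl (E \ {x, v}) → x ∈ C := by
    intro x hx hxv hspan
    by_contra hxC
    refine hC.1 ((hpair x hx hxv hspan).subset fun z hz => ⟨(hCE hz).1, ?_⟩)
    rintro (rfl | h)
    · exact hxC hz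
    · exact (hCE hz).2 h
  have hUC : U ⊆ C := by
    intro u hu
    have huV := Set.disjoint_left.1 hUV hu
    refine hmem u (hUVE (Or.inl hu)) (fun h => huV (h ▸ hv)) ?_
    exact G.subset_cl_diff_pair hmd1 hmd2 hUVE hVWE (Or.inl hu)
      (fun h => h.elim huV (Set.disjoint_left.1 hUW hu)) (Or.inl hv)
  have hWC : W ⊆ C := by
    intro w hw
    have hwV := Set.disjoint_right.1 hVW hw
    refine hmem w (hVWE (Or.inr hw)) (fun h => hwV (h ▸ hv)) ?_
    exact G.subset_cl_diff_pair hmd2 hmd1 hVWE hUVE (Or.inr hw)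
      (fun h => h.elim (Set.disjoint_right.1 hUW hw) hwV) (Or.inr hv)
  refine ⟨C ∩ V, ⟨Set.inter_subset_right, fun h => (hCE (h hv).1).2 rfl⟩, ?_⟩
  have heq : U ∪ C ∩ V ∪ W = C := by
    apply Set.Subset.antisymm
    · exact Set.union_subset (Set.union_subset hUC Set.inter_subset_left) hWC
    · intro z hz
      rcases (hCE hz).1 with (hzU | hzV) | hzW
      exacts [Or.inl (Or.inl hzU), Or.inl (Or.inr ⟨hz, hzV⟩), Or.inr hzW]
  rwa [heq]
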